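/- Fix an integer T ≥ 1. The system satisfies quadratic performance specified by P if and only if the lifted system η(k+1) = Ã η(k) + B̃ w̃(k), z̃(k) = C̃ η(k) + D̃ w̃(k) (viewed as a discrete-time linear time-invariant system with state η ∈ ℝ^n, input w̃ ∈ ℝ^{Tm}, output z̃ ∈ ℝ^{Tq}) satisfies quadratic performance specified by P̃. -/

import Mathlib

open Matrix Filter Topology Kronecker

/-- Trajectories of a discrete-time LTI system
`x(t+1) = 𝒜 x(t) + ℬ u(t)`, `y(t) = 𝒞 x(t) + 𝒟 u(t)`. -/
def IsTraj {St In Out : Type*} [Fintype St] [Fintype In] [Fintype Out]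
    (A : Matrix St St ℝ) (B : Matrix St In ℝ) (C : Matrix Out St ℝ) (D : Matrix Out In ℝ)
    (x : ℕ → St → ℝ) (u : ℕ → In → ℝ) (y : ℕ → Out → ℝ) : Prop :=
  ∀ t : ℕ, x (t + 1) = A.mulVec (x t) + B.mulVec (u t) ∧
    y t = C.mulVec (x t) + D.mulVec (u t)

/-- The system satisfies quadratic performance specified by `Π`. -/
def QuadPerf {St In Out : Type*} [Fintype St] [Fintype In] [Fintype Out]
    (A : Matrix St St ℝ) (B : Matrix St In ℝ) (C : Matrix Out St ℝ) (D : Matrix Out In ℝ)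
    (P : Matrix (In ⊕ Out) (In ⊕ Out) ℝ) : Prop :=
  (∀ x : ℕ → St → ℝ, (∀ t : ℕ, x (t + 1) = A.mulVec (x t)) →
      Tendsto x atTop (𝓝 0)) ∧
  ∃ ε > (0 : ℝ), ∀ x u y, IsTraj A B C D x u y → x 0 = 0 →
    Summable (fun t => u t ⬝ᵥ u t) →
    ∃ l : ℝ,
      Tendsto (fun N => ∑ t ∈ Finset.range N,
        Sum.elim (u t) (y t) ⬝ᵥ P.mulVec (Sum.elim (u t) (y t))) atTop (𝓝 l) ∧
      l ≤ -ε * ∑' t, u t ⬝ᵥ u t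

/-- Lifted input matrix `B̃ = [A^{T-1}B, A^{T-2}B, …, B]`. -/
noncomputable def Btil {n m : ℕ} (T : ℕ) (A : Matrix (Fin n) (Fin n) ℝ)
    (B : Matrix (Fin n) (Fin m) ℝ) : Matrix (Fin n) (Fin T × Fin m) ℝ :=
  Matrix.of fun i p => (A ^ (T - 1 - (p.1 : ℕ)) * B) i p.2

/-- Lifted output matrix `C̃` with block rows `C, CA, …, CA^{T-1}`. -/
noncomputable def Ctil {n q : ℕ} (T : ℕ) (A : Matrix (Fin n) (Fin n) ℝ)
    (C : Matrix (Fin q) (Fin n) ℝ) : Matrix (Fin T × Fin q) (Fin n) ℝ :=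
  Matrix.of fun p j => (C * A ^ (p.1 : ℕ)) p.2 j

/-- Lifted feedthrough matrix `D̃`, block lower triangular with `(i,j)` block `D` if
`i = j`, `C A^{i-j-1} B` if `i > j`, and `0` if `i < j`. -/
noncomputable def Dtil {n m q : ℕ} (T : ℕ) (A : Matrix (Fin n) (Fin n) ℝ)
    (B : Matrix (Fin n) (Fin m) ℝ) (C : Matrix (Fin q) (Fin n) ℝ)
    (D : Matrix (Fin q) (Fin m) ℝ) : Matrix (Fin T × Fin q) (Fin T × Fin m) ℝ :=
  Matrix.of fun p r =>
    if (p.1 : ℕ) = (r.1 : ℕ) then D p.2 r.2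
    else if (r.1 : ℕ) < (p.1 : ℕ) then
      (C * A ^ ((p.1 : ℕ) - (r.1 : ℕ) - 1) * B) p.2 r.2
    else 0

/-- The lifted performance matrix `P̃ = [[I_T ⊗ Q, I_T ⊗ S], [I_T ⊗ Sᵀ, I_T ⊗ R]]`. -/
noncomputable def Ptil {m q : ℕ} (T : ℕ) (Q : Matrix (Fin m) (Fin m) ℝ)
    (S : Matrix (Fin m) (Fin q) ℝ) (R : Matrix (Fin q) (Fin q) ℝ) :
    Matrix ((Fin T × Fin m) ⊕ (Fin T × Fin q)) ((Fin T × Fin m) ⊕ (Fin T × Fin q)) ℝ :=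
  Matrix.fromBlocks ((1 : Matrix (Fin T) (Fin T) ℝ) ⊗ₖ Q)
    ((1 : Matrix (Fin T) (Fin T) ℝ) ⊗ₖ S)
    ((1 : Matrix (Fin T) (Fin T) ℝ) ⊗ₖ Sᵀ)
    ((1 : Matrix (Fin T) (Fin T) ℝ) ⊗ₖ R)

theorem aux_sum_block (f : ℕ → ℝ) (T K : ℕ) :
    ∑ k ∈ Finset.range K, ∑ i : Fin T, f (T * k + i) = ∑ t ∈ Finset.range (T * K), f t := by
  induction K with
  | zero => simp
  | succ K ih =>
    rw [Finset.sum_range_succ, ih, Nat.mul_succ, Finset.sum_range_add,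
      Finset.sum_range (n := T)]

theorem aux_residue {X : Type*} [TopologicalSpace X] (T : ℕ) (hT : 1 ≤ T) (g : ℕ → X) (l : X)
    (h : ∀ r < T, Tendsto (fun k => g (T * k + r)) atTop (𝓝 l)) : Tendsto g atTop (𝓝 l) := by
  rw [tendsto_def]
  intro s hs
  have h1 : ∀ᶠ k in atTop, ∀ r ∈ Finset.range T, g (T * k + r) ∈ s := by
    rw [Filter.eventually_all_finset]
    intro r hr
    exact (h r (Finset.mem_range.1 hr)).eventually_mem hs
  have h2 := (Nat.tendsto_div_const_atTop (n := T) (by omega)).eventually h1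
  filter_upwards [h2] with n hn
  have := hn (n % T) (Finset.mem_range.2 (Nat.mod_lt _ (by omega)))
  rwa [Nat.div_add_mod] at this

theorem aux_mul_tendsto (T : ℕ) (hT : 1 ≤ T) (r : ℕ) :
    Tendsto (fun k => T * k + r) atTop atTop :=
  tendsto_atTop_mono (fun k => (Nat.le_mul_of_pos_left k hT).trans (Nat.le_add_right _ r)) tendsto_id

theorem aux_rec_one (a b : ℕ → ℝ) (ha : ∀ k, 0 ≤ a k) (hb : Tendsto b atTop (𝓝 0))
    (h : ∀ k, a (k + 1) ≤ a k / 2 + b k) : Tendsto a atTop (𝓝 0) := by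
  rw [Metric.tendsto_atTop]
  intro ε hε
  obtain ⟨K, hK⟩ := (Metric.tendsto_atTop.1 hb) (ε / 4) (by positivity)
  have h1 : ∀ j, a (K + j) ≤ a K * (1 / 2) ^ j + ε / 2 := by
    intro j
    induction j with
    | zero => simp; linarith
    | succ j ih =>
      have h2 := h (K + j)
      have h3 := hK (K + j) (by omega)
      rw [Real.dist_eq, sub_zero] at h3
      have h4 := (abs_lt.1 h3).2
      rw [← add_assoc, pow_succ]
      linarith
  have h5 : Tendsto (fun j : ℕ => a K * (1 / 2 : ℝ) ^ j) atTop (𝓝 (a K * 0)) :=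
    (tendsto_pow_atTop_nhds_zero_of_lt_one (by norm_num) (by norm_num)).const_mul _
  rw [mul_zero] at h5
  obtain ⟨J, hJ⟩ := (Metric.tendsto_atTop.1 h5) (ε / 2) (by positivity)
  refine ⟨K + J, fun n hn => ?_⟩
  obtain ⟨j, rfl⟩ : ∃ j, n = K + j := ⟨n - K, by omega⟩
  have h6 := hJ j (by omega)
  rw [Real.dist_eq, sub_zero] at h6
  have h7 := (abs_lt.1 h6).2
  rw [Real.dist_eq, sub_zero, abs_of_nonneg (ha _)]
  linarith [h1 j]

theorem aux_rec (N : ℕ) (hN : 1 ≤ N) (a b : ℕ → ℝ) (ha : ∀ k, 0 ≤ a k)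
    (hb : Tendsto b atTop (𝓝 0))
    (h : ∀ k, a (k + N) ≤ a k / 2 + b k) : Tendsto a atTop (𝓝 0) := by
  refine aux_residue N hN a 0 fun r _ => ?_
  refine aux_rec_one _ (fun k => b (N * k + r)) (fun k => ha _)
    (hb.comp (aux_mul_tendsto N hN r)) fun k => ?_
  have := h (N * k + r)
  rwa [show N * k + r + N = N * (k + 1) + r by ring] at this

theorem aux_formula {n m : ℕ} (A : Matrix (Fin n) (Fin n) ℝ) (B : Matrix (Fin n) (Fin m) ℝ)
    (x : ℕ → Fin n → ℝ) (u : ℕ → Fin m → ℝ)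
    (h : ∀ t, x (t + 1) = A.mulVec (x t) + B.mulVec (u t)) (t s : ℕ) :
    x (t + s) = (A ^ s).mulVec (x t) +
      ∑ i ∈ Finset.range s, (A ^ (s - 1 - i) * B).mulVec (u (t + i)) := by
  induction s with
  | zero => simp
  | succ s ih =>
    rw [← add_assoc, h, ih, Finset.sum_range_succ, Matrix.mulVec_add, Matrix.mulVec_mulVec,
      ← pow_succ', add_assoc]
    congr 1
    congr 1
    · rw [Matrix.mulVec_sum]
      refine Finset.sum_congr rfl fun i hi => ?_
      have hi := Finset.mem_range.1 hi
      rw [Matrix.mulVec_mulVec, ← Matrix.mul_assoc, ← pow_succ']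
      congr 4
      omega
    · simp

theorem aux_free {n : ℕ} (A : Matrix (Fin n) (Fin n) ℝ)
    (x : ℕ → Fin n → ℝ) (h : ∀ t, x (t + 1) = A.mulVec (x t)) (t s : ℕ) :
    x (t + s) = (A ^ s).mulVec (x t) := by
  induction s with
  | zero => simp
  | succ s ih => rw [← add_assoc, h, ih, Matrix.mulVec_mulVec, ← pow_succ']

theorem aux_stable_iff {n : ℕ} (T : ℕ) (hT : 1 ≤ T) (A : Matrix (Fin n) (Fin n) ℝ) :
    (∀ x : ℕ → Fin n → ℝ, (∀ t : ℕ, x (t + 1) = A.mulVec (x t)) → Tendsto x atTop (𝓝 0)) ↔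
    (∀ x : ℕ → Fin n → ℝ, (∀ t : ℕ, x (t + 1) = (A ^ T).mulVec (x t)) →
      Tendsto x atTop (𝓝 0)) := by
  constructor
  · intro H x hx
    have h1 := H (fun t => (A ^ t).mulVec (x 0)) (fun t => by
      rw [Matrix.mulVec_mulVec, ← pow_succ'])
    have h2 := h1.comp (aux_mul_tendsto T hT 0)
    refine h2.congr fun k => ?_
    have := aux_free _ x hx 0 k
    rw [zero_add, ← pow_mul] at this
    simp [this]
  · intro H x hx
    refine aux_residue T hT x 0 fun r _ => ?_
    refine H _ fun k => ?_
    rw [← aux_free A x hx]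
    congr 1
    ring

theorem aux_contr {n : ℕ} (A : Matrix (Fin n) (Fin n) ℝ)
    (H : ∀ x : ℕ → Fin n → ℝ, (∀ t : ℕ, x (t + 1) = A.mulVec (x t)) → Tendsto x atTop (𝓝 0)) :
    ∃ N ≥ 1, ∀ v : Fin n → ℝ, ‖(A ^ N).mulVec v‖ ≤ ‖v‖ / 2 := by
  have h1 : ∀ i j, Tendsto (fun t => (A ^ t) i j) atTop (𝓝 0) := by
    intro i j
    have h2 := H (fun t => (A ^ t).mulVec (Pi.single j 1)) (fun t => by
      rw [Matrix.mulVec_mulVec, ← pow_succ'])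
    have h3 := (tendsto_pi_nhds.1 h2) i
    simpa using h3
  have hc : (0 : ℝ) < 1 / (2 * (n + 1)) := by positivity
  have h4 : ∀ᶠ t in atTop, ∀ i j, |(A ^ t) i j| < 1 / (2 * (n + 1)) := by
    rw [Filter.eventually_all]
    intro i
    rw [Filter.eventually_all]
    intro j
    have := (h1 i j).abs
    rw [abs_zero] at this
    exact this.eventually (gt_mem_nhds hc)
  obtain ⟨N, hN, hN1⟩ := (h4.and (eventually_ge_atTop 1)).exists
  refine ⟨N, hN1, fun v => ?_⟩
  rw [pi_norm_le_iff_of_nonneg (by positivity)]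
  intro i
  rw [Real.norm_eq_abs]
  calc |((A ^ N).mulVec v) i| = |∑ j, (A ^ N) i j * v j| := rfl
    _ ≤ ∑ j, |(A ^ N) i j * v j| := Finset.abs_sum_le_sum_abs _ _
    _ ≤ ∑ j : Fin n, 1 / (2 * ((n : ℝ) + 1)) * ‖v‖ := by
      refine Finset.sum_le_sum fun j _ => ?_
      rw [abs_mul]
      exact mul_le_mul (hN i j).le (norm_le_pi_norm v j) (abs_nonneg _) hc.le
    _ = (n : ℝ) / (n + 1) * (‖v‖ / 2) := by
      simp
      field_simp
    _ ≤ 1 * (‖v‖ / 2) := by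
      refine mul_le_mul_of_nonneg_right ?_ (by positivity)
      rw [div_le_one (by positivity)]
      linarith
    _ = ‖v‖ / 2 := one_mul _

theorem aux_mulVec_tendsto {n m : ℕ} (M : Matrix (Fin n) (Fin m) ℝ) (u : ℕ → Fin m → ℝ)
    (hu : Tendsto u atTop (𝓝 0)) : Tendsto (fun t => M.mulVec (u t)) atTop (𝓝 0) := by
  have hc : Continuous fun v : Fin m → ℝ => M.mulVec v := by fun_prop
  have := (hc.tendsto 0).comp hu
  simpa [Function.comp_def] using this

theorem aux_state_tendsto {n m : ℕ} (A : Matrix (Fin n) (Fin n) ℝ) (B : Matrix (Fin n) (Fin m) ℝ)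
    (H : ∀ x : ℕ → Fin n → ℝ, (∀ t : ℕ, x (t + 1) = A.mulVec (x t)) → Tendsto x atTop (𝓝 0))
    (x : ℕ → Fin n → ℝ) (u : ℕ → Fin m → ℝ)
    (h : ∀ t, x (t + 1) = A.mulVec (x t) + B.mulVec (u t)) (hu : Tendsto u atTop (𝓝 0)) :
    Tendsto x atTop (𝓝 0) := by
  obtain ⟨N, hN, hc⟩ := aux_contr A H
  rw [tendsto_zero_iff_norm_tendsto_zero]
  refine aux_rec N hN _
    (fun t => ‖∑ i ∈ Finset.range N, (A ^ (N - 1 - i) * B).mulVec (u (t + i))‖)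
    (fun _ => norm_nonneg _) ?_ fun k => ?_
  · rw [← tendsto_zero_iff_norm_tendsto_zero]
    have : (0 : Fin n → ℝ) = ∑ i ∈ Finset.range N, 0 := by simp
    rw [this]
    refine tendsto_finsetSum _ fun i _ => ?_
    exact aux_mulVec_tendsto _ _ (hu.comp (tendsto_add_atTop_nat i))
  · rw [aux_formula A B x u h k N]
    exact (norm_add_le _ _).trans (add_le_add_left (hc _) _)

theorem aux_input_tendsto {m : ℕ} (u : ℕ → Fin m → ℝ) (h : Summable (fun t => u t ⬝ᵥ u t)) :
    Tendsto u atTop (𝓝 0) := by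
  rw [tendsto_pi_nhds]
  intro i
  have h1 := h.tendsto_atTop_zero
  have h2 : Tendsto (fun t => u t i ^ 2) atTop (𝓝 0) := by
    refine squeeze_zero (fun t => sq_nonneg _) (fun t => ?_) h1
    rw [sq]
    exact Finset.single_le_sum (f := fun j => u t j * u t j)
      (fun j _ => mul_self_nonneg _) (Finset.mem_univ i)
  have h3 := h2.sqrt
  simp only [Real.sqrt_sq_eq_abs, Real.sqrt_zero] at h3
  exact (tendsto_zero_iff_abs_tendsto_zero _).2 h3

theorem aux_quad_tendsto {m q : ℕ} (P : Matrix (Fin m ⊕ Fin q) (Fin m ⊕ Fin q) ℝ)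
    (u : ℕ → Fin m → ℝ) (y : ℕ → Fin q → ℝ)
    (hu : Tendsto u atTop (𝓝 0)) (hy : Tendsto y atTop (𝓝 0)) :
    Tendsto (fun t => Sum.elim (u t) (y t) ⬝ᵥ P.mulVec (Sum.elim (u t) (y t))) atTop (𝓝 0) := by
  have h1 : Tendsto (fun t => Sum.elim (u t) (y t)) atTop (𝓝 0) := by
    rw [tendsto_pi_nhds] at hu hy ⊢
    rintro (i | i)
    · exact hu i
    · exact hy i
  have hc : Continuous fun v : Fin m ⊕ Fin q → ℝ => v ⬝ᵥ P.mulVec v := by fun_prop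
  have := (hc.tendsto 0).comp h1
  simpa [Function.comp_def] using this

theorem aux_B {n m : ℕ} (T : ℕ) (A : Matrix (Fin n) (Fin n) ℝ) (B : Matrix (Fin n) (Fin m) ℝ)
    (w : ℕ → Fin m → ℝ) :
    (Btil T A B).mulVec (fun p => w p.1 p.2) =
      ∑ i ∈ Finset.range T, (A ^ (T - 1 - i) * B).mulVec (w i) := by
  ext a
  rw [Finset.sum_apply, Finset.sum_range (n := T)]
  simp only [Matrix.mulVec, dotProduct, Btil, Matrix.of_apply, Fintype.sum_prod_type]

theorem aux_C {n q : ℕ} (T : ℕ) (A : Matrix (Fin n) (Fin n) ℝ) (C : Matrix (Fin q) (Fin n) ℝ)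
    (v : Fin n → ℝ) (p : Fin T × Fin q) :
    (Ctil T A C).mulVec v p = (C.mulVec ((A ^ (p.1 : ℕ)).mulVec v)) p.2 := by
  rw [Matrix.mulVec_mulVec]
  rfl

theorem aux_D {n m q : ℕ} (T : ℕ) (A : Matrix (Fin n) (Fin n) ℝ)
    (B : Matrix (Fin n) (Fin m) ℝ) (C : Matrix (Fin q) (Fin n) ℝ)
    (D : Matrix (Fin q) (Fin m) ℝ) (w : ℕ → Fin m → ℝ) (p : Fin T × Fin q) :
    (Dtil T A B C D).mulVec (fun p => w p.1 p.2) p =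
      (C.mulVec (∑ i ∈ Finset.range p.1, (A ^ ((p.1 : ℕ) - 1 - i) * B).mulVec (w i)) +
        D.mulVec (w p.1)) p.2 := by
  obtain ⟨a, b⟩ := p
  have h1 : (Dtil T A B C D).mulVec (fun p => w p.1 p.2) (a, b) =
      ∑ r ∈ Finset.range T, (if (a : ℕ) = r then D.mulVec (w r) b
        else if r < (a : ℕ) then (C * A ^ ((a : ℕ) - r - 1) * B).mulVec (w r) b else 0) := by
    rw [Finset.sum_range (n := T)]
    simp only [Matrix.mulVec, dotProduct, Dtil, Matrix.of_apply, Fintype.sum_prod_type]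
    refine Finset.sum_congr rfl fun r _ => ?_
    split_ifs <;> simp
  rw [h1, ← Finset.sum_subset (s₁ := Finset.range (a + 1))]
  · rw [Finset.sum_range_succ, Matrix.mulVec_sum, Pi.add_apply, Finset.sum_apply]
    simp only [if_true]
    congr 1
    refine Finset.sum_congr rfl fun i hi => ?_
    have hi := Finset.mem_range.1 hi
    rw [if_neg (by omega), if_pos hi, Matrix.mulVec_mulVec, Nat.sub_right_comm, Matrix.mul_assoc]
  · intro i hi
    have := a.2
    simp only [Finset.mem_range] at hi ⊢
    omega
  · intro i _ hi
    simp only [Finset.mem_range] at hi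
    rw [if_neg (by omega), if_neg (by omega)]

theorem aux_kron {a b : ℕ} (T : ℕ) (M : Matrix (Fin a) (Fin b) ℝ) (v : Fin T → Fin b → ℝ) :
    ((1 : Matrix (Fin T) (Fin T) ℝ) ⊗ₖ M).mulVec (fun p => v p.1 p.2) =
      fun p => M.mulVec (v p.1) p.2 := by
  ext ⟨i, j⟩
  simp only [Matrix.mulVec, dotProduct, Fintype.sum_prod_type, Matrix.kroneckerMap_apply,
    Matrix.one_apply]
  rw [Finset.sum_eq_single i]
  · simp
  · intro k _ hk
    simp [hk.symm]
  · simp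

theorem aux_quad {m q : ℕ} (T : ℕ) (Q : Matrix (Fin m) (Fin m) ℝ)
    (S : Matrix (Fin m) (Fin q) ℝ) (R : Matrix (Fin q) (Fin q) ℝ)
    (u : Fin T → Fin m → ℝ) (y : Fin T → Fin q → ℝ) :
    Sum.elim (fun p : Fin T × Fin m => u p.1 p.2) (fun p : Fin T × Fin q => y p.1 p.2) ⬝ᵥ
      (Ptil T Q S R).mulVec
        (Sum.elim (fun p : Fin T × Fin m => u p.1 p.2) (fun p : Fin T × Fin q => y p.1 p.2)) =
    ∑ i, Sum.elim (u i) (y i) ⬝ᵥ (Matrix.fromBlocks Q S Sᵀ R).mulVec (Sum.elim (u i) (y i)) := by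
  simp only [Ptil, Matrix.fromBlocks_mulVec, Sum.elim_comp_inl, Sum.elim_comp_inr, aux_kron]
  simp only [dotProduct, Fintype.sum_sum_type, Sum.elim_inl, Sum.elim_inr,
    Fintype.sum_prod_type, Pi.add_apply, Finset.sum_add_distrib]

theorem aux_lift {n m q : ℕ} (T : ℕ)
    (A : Matrix (Fin n) (Fin n) ℝ) (B : Matrix (Fin n) (Fin m) ℝ)
    (C : Matrix (Fin q) (Fin n) ℝ) (D : Matrix (Fin q) (Fin m) ℝ)
    (x : ℕ → Fin n → ℝ) (u : ℕ → Fin m → ℝ) (y : ℕ → Fin q → ℝ) (h : IsTraj A B C D x u y) :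
    IsTraj (A ^ T) (Btil T A B) (Ctil T A C) (Dtil T A B C D) (fun k => x (T * k))
      (fun k p => u (T * k + p.1) p.2) (fun k p => y (T * k + p.1) p.2) := by
  intro k
  have hf := aux_formula A B x u (fun t => (h t).1) (T * k)
  constructor
  · rw [aux_B T A B (fun i => u (T * k + i)), ← hf T]
    rfl
  · ext p
    rw [Pi.add_apply, aux_C, aux_D T A B C D (fun i => u (T * k + i)), ← Pi.add_apply,
      ← add_assoc, ← Matrix.mulVec_add, ← hf, ← (h _).2]

theorem aux_sumsq {m : ℕ} (T : ℕ) (u : ℕ → Fin m → ℝ) (k : ℕ) :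
    (fun p : Fin T × Fin m => u (T * k + p.1) p.2) ⬝ᵥ
      (fun p : Fin T × Fin m => u (T * k + p.1) p.2) =
    ∑ i : Fin T, u (T * k + i) ⬝ᵥ u (T * k + i) := by
  simp only [dotProduct, Fintype.sum_prod_type]

theorem aux_summable (T : ℕ) (hT : 1 ≤ T) (f : ℕ → ℝ) (hf : ∀ t, 0 ≤ f t)
    (h : Summable (fun k => ∑ i : Fin T, f (T * k + i))) : Summable f := by
  have hg : ∀ k, 0 ≤ ∑ i : Fin T, f (T * k + i) := fun k => Finset.sum_nonneg fun i _ => hf _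
  refine summable_of_sum_range_le (c := ∑' k, ∑ i : Fin T, f (T * k + i)) hf fun K => ?_
  calc ∑ t ∈ Finset.range K, f t ≤ ∑ t ∈ Finset.range (T * K), f t := by
        refine Finset.sum_le_sum_of_subset_of_nonneg (fun i hi => ?_) fun i _ _ => hf i
        simp only [Finset.mem_range] at hi ⊢
        nlinarith
    _ = ∑ k ∈ Finset.range K, ∑ i : Fin T, f (T * k + i) := (aux_sum_block f T K).symm
    _ ≤ _ := h.sum_le_tsum _ fun i _ => hg i

theorem aux_hasSum (T : ℕ) (hT : 1 ≤ T) (f : ℕ → ℝ) (hf : ∀ t, 0 ≤ f t)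
    (h : Summable f) : HasSum (fun k => ∑ i : Fin T, f (T * k + i)) (∑' t, f t) := by
  rw [hasSum_iff_tendsto_nat_of_nonneg (fun k => Finset.sum_nonneg fun i _ => hf _)]
  simp only [aux_sum_block]
  exact h.hasSum.tendsto_sum_nat.comp (aux_mul_tendsto T hT 0)

theorem aux_partial (T : ℕ) (hT : 1 ≤ T) (f : ℕ → ℝ) (l : ℝ) (hf : Tendsto f atTop (𝓝 0))
    (h : Tendsto (fun K => ∑ k ∈ Finset.range K, ∑ i : Fin T, f (T * k + i)) atTop (𝓝 l)) :
    Tendsto (fun K => ∑ t ∈ Finset.range K, f t) atTop (𝓝 l) := by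
  simp only [aux_sum_block] at h
  refine aux_residue T hT _ l fun r _ => ?_
  induction r with
  | zero => simpa using h
  | succ r ih =>
    have h1 := (ih (by omega)).add (hf.comp (aux_mul_tendsto T hT r))
    rw [add_zero] at h1
    refine h1.congr fun k => ?_
    rw [← add_assoc, Finset.sum_range_succ]
    rfl

/-- State of the unlifted system started at zero. -/
noncomputable def auxState {n m : ℕ} (A : Matrix (Fin n) (Fin n) ℝ) (B : Matrix (Fin n) (Fin m) ℝ)
    (u : ℕ → Fin m → ℝ) : ℕ → Fin n → ℝ
  | 0 => 0
  | t + 1 => A.mulVec (auxState A B u t) + B.mulVec (u t)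

/-- The system satisfies quadratic performance specified by `P` if and only if the
`T`-step lifted system satisfies quadratic performance specified by `P̃`. -/
theorem quadPerf_iff_lifted {n m q : ℕ} (T : ℕ) (hT : 1 ≤ T)
    (A : Matrix (Fin n) (Fin n) ℝ) (B : Matrix (Fin n) (Fin m) ℝ)
    (C : Matrix (Fin q) (Fin n) ℝ) (D : Matrix (Fin q) (Fin m) ℝ)
    (Q : Matrix (Fin m) (Fin m) ℝ) (S : Matrix (Fin m) (Fin q) ℝ)
    (R : Matrix (Fin q) (Fin q) ℝ) (hQ : Q.IsSymm) (hR : R.IsSymm) :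
    QuadPerf A B C D (Matrix.fromBlocks Q S Sᵀ R) ↔
      QuadPerf (A ^ T) (Btil T A B) (Ctil T A C) (Dtil T A B C D) (Ptil T Q S R) := by
  have hsq : ∀ (u : ℕ → Fin m → ℝ) (t : ℕ), 0 ≤ u t ⬝ᵥ u t := fun u t =>
    Finset.sum_nonneg fun j _ => mul_self_nonneg _
  constructor
  · rintro ⟨hs, ε, hε, H⟩
    refine ⟨(aux_stable_iff T hT A).1 hs, ε, hε, fun x' u' y' ht h0 hsum => ?_⟩
    obtain ⟨u, hu⟩ : ∃ u : ℕ → Fin m → ℝ, u' = fun k p => u (T * k + p.1) p.2 := by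
      refine ⟨fun t j => u' (t / T) (⟨t % T, Nat.mod_lt _ hT⟩, j), ?_⟩
      ext k ⟨i, j⟩
      have h1 : (T * k + i) / T = k := by
        rw [Nat.mul_add_div hT, Nat.div_eq_of_lt i.2, add_zero]
      have h2 : (⟨(T * k + i) % T, Nat.mod_lt _ hT⟩ : Fin T) = i := by
        ext
        simp [Nat.mod_eq_of_lt i.2]
      simp only [h1, h2]
    let x := auxState A B u
    let y : ℕ → Fin q → ℝ := fun t => C.mulVec (x t) + D.mulVec (u t)
    have htr : IsTraj A B C D x u y := fun t => ⟨rfl, rfl⟩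
    have hl := aux_lift T A B C D x u y htr
    have hx : x' = fun k => x (T * k) := by
      funext k
      induction k with
      | zero => rw [h0]; rfl
      | succ k ih =>
        rw [(ht k).1, ih, hu]
        exact (hl k).1.symm
    have hy : y' = fun k p => y (T * k + p.1) p.2 := by
      funext k
      rw [(ht k).2, hx, hu]
      exact (hl k).2.symm
    subst hu hy
    simp only [aux_sumsq] at hsum ⊢
    have hsu := aux_summable T hT (fun t => u t ⬝ᵥ u t) (hsq u) hsum
    obtain ⟨l, hl1, hl2⟩ := H x u y htr rfl hsu
    refine ⟨l, ?_, ?_⟩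
    · have h3 := hl1.comp (aux_mul_tendsto T hT 0)
      refine h3.congr fun K => ?_
      simp only [Function.comp_apply, add_zero]
      rw [← aux_sum_block]
      refine Finset.sum_congr rfl fun k _ => ?_
      exact (aux_quad T Q S R (fun i => u (T * k + i)) (fun i => y (T * k + i))).symm
    · rw [(aux_hasSum T hT (fun t => u t ⬝ᵥ u t) (hsq u) hsu).tsum_eq]
      exact hl2
  · rintro ⟨hs, ε, hε, H⟩
    have hs' := (aux_stable_iff T hT A).2 hs
    refine ⟨hs', ε, hε, fun x u y ht h0 hsum => ?_⟩
    have hS := aux_hasSum T hT (fun t => u t ⬝ᵥ u t) (hsq u) hsum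
    obtain ⟨l, hl1, hl2⟩ := H _ _ _ (aux_lift T A B C D x u y ht) (by simpa using h0) (by
      simp only [aux_sumsq]
      exact hS.summable)
    simp only [aux_sumsq] at hl2
    rw [hS.tsum_eq] at hl2
    refine ⟨l, ?_, hl2⟩
    have hu := aux_input_tendsto u hsum
    have hx := aux_state_tendsto A B hs' x u (fun t => (ht t).1) hu
    have hy : Tendsto y atTop (𝓝 0) := by
      have h1 := (aux_mulVec_tendsto C x hx).add (aux_mulVec_tendsto D u hu)
      rw [add_zero] at h1
      exact h1.congr fun t => ((ht t).2).symm
    refine aux_partial T hT _ l (aux_quad_tendsto _ u y hu hy) ?_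
    refine hl1.congr fun K => Finset.sum_congr rfl fun k _ => ?_
    exact aux_quad T Q S R (fun i => u (T * k + i)) (fun i => y (T * k + i))
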